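/- Let X be a commutative and cocommutative Hopf algebra over a commutative ring k with S ∘ S = id, let λ : X → k be a two-sided integral functional and γ ∈ X a two-sided cointegral. Set V = X⊗X, ∪(a⊗b) = λ(a·S(b)), ∩(1) = Δ(γ), μ₂ = id_X ⊗ ∪ ⊗ id_X : V⊗V → V, Δ₂ = id_X ⊗ ∩ ⊗ id_X : V → V⊗V. Let β : V⊗V → V⊗V be the braiding β(x⊗y⊗z⊗w) = z⁽¹⁾ ⊗ w⁽¹⁾ ⊗ x·S(z⁽²⁾)·w⁽²⁾ ⊗ y·S(z⁽³⁾)·w⁽³⁾, let θ : V → V be the twist θ(x⊗y) = T(x⁽¹⁾⊗x⁽²⁾⊗y⁽²⁾) ⊗ T(y⁽¹⁾⊗x⁽³⁾⊗y⁽³⁾) with T(x⊗y⊗z) = x·S(y)·z, and set θ₂ = β ∘ β ∘ (θ ⊗ θ) : V⊗V → V⊗V. Then the twist commutes with multiplication and comultiplication: θ ∘ μ₂ = μ₂ ∘ θ₂ and Δ₂ ∘ θ = θ₂ ∘ Δ₂. -/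

import Mathlib

open TensorProduct

/-- The finite family `(x1 i) ⊗ (x2 i)` represents the comultiplication of `x`. -/
def Rep2 (k : Type*) {X : Type*} [CommRing k] [AddCommMonoid X] [Module k X] [Coalgebra k X]
    (x : X) {n : ℕ} (x1 x2 : Fin n → X) : Prop :=
  Coalgebra.comul (R := k) x = ∑ i, x1 i ⊗ₜ[k] x2 i

/-- The twofold iterated comultiplication `x ↦ x⁽¹⁾ ⊗ (x⁽²⁾ ⊗ x⁽³⁾)`. -/
noncomputable def delta3 (k : Type*) {X : Type*} [CommRing k] [AddCommMonoid X] [Module k X]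
    [Coalgebra k X] : X →ₗ[k] X ⊗[k] (X ⊗[k] X) :=
  (LinearMap.lTensor X (Coalgebra.comul (R := k))) ∘ₗ Coalgebra.comul

/-- The finite family `(x1 i) ⊗ (x2 i) ⊗ (x3 i)` represents the iterated comultiplication
`x⁽¹⁾ ⊗ x⁽²⁾ ⊗ x⁽³⁾` of `x`. -/
def Rep3 (k : Type*) {X : Type*} [CommRing k] [AddCommMonoid X] [Module k X] [Coalgebra k X]
    (x : X) {n : ℕ} (x1 x2 x3 : Fin n → X) : Prop :=
  delta3 k x = ∑ i, x1 i ⊗ₜ[k] (x2 i ⊗ₜ[k] x3 i)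

/-- `lam` is a two-sided integral functional. -/
def IsIntegralFunctional (k : Type*) {X : Type*} [CommRing k] [Ring X] [HopfAlgebra k X]
    (lam : X →ₗ[k] k) : Prop :=
  ∀ (x : X) {n : ℕ} (x1 x2 : Fin n → X), Rep2 k x x1 x2 →
    (∑ i, lam (x2 i) • x1 i = lam x • (1 : X)) ∧ (∑ i, lam (x1 i) • x2 i = lam x • (1 : X))

/-- `γ` is a two-sided cointegral. -/
def IsCointegral (k : Type*) {X : Type*} [CommRing k] [Ring X] [HopfAlgebra k X]
    (γ : X) : Prop :=
  ∀ x : X, x * γ = Coalgebra.counit (R := k) x • γ ∧ γ * x = Coalgebra.counit (R := k) x • γ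

open WithConv

section Representations

variable {k X : Type*} [CommRing k]

lemma TensorProduct.exists_fin_sum_tmul {M N : Type*} [AddCommMonoid M] [AddCommMonoid N]
    [Module k M] [Module k N] (t : M ⊗[k] N) :
    ∃ (n : ℕ) (a : Fin n → M) (b : Fin n → N), t = ∑ i, a i ⊗ₜ[k] b i := by
  obtain ⟨s, rfl⟩ := TensorProduct.exists_finset t
  refine ⟨s.card, fun i => (s.equivFin.symm i).1.1, fun i => (s.equivFin.symm i).1.2, ?_⟩
  rw [s.equivFin.symm.sum_comp fun p : s => p.1.1 ⊗ₜ[k] p.1.2,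
    Finset.sum_coe_sort s fun p => p.1 ⊗ₜ[k] p.2]

lemma exists_rep2 [AddCommMonoid X] [Module k X] [Coalgebra k X] (x : X) :
    ∃ (n : ℕ) (x1 x2 : Fin n → X), Rep2 k x x1 x2 :=
  TensorProduct.exists_fin_sum_tmul _

lemma TensorProduct.exists_fin_sum_tmul_tmul {M N P : Type*} [AddCommMonoid M] [AddCommMonoid N]
    [AddCommMonoid P] [Module k M] [Module k N] [Module k P] (t : M ⊗[k] (N ⊗[k] P)) :
    ∃ (n : ℕ) (a : Fin n → M) (b : Fin n → N) (c : Fin n → P),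
      t = ∑ i, a i ⊗ₜ[k] (b i ⊗ₜ[k] c i) := by
  obtain ⟨n, a, u, rfl⟩ := TensorProduct.exists_fin_sum_tmul t
  choose m b c hu using fun i => TensorProduct.exists_fin_sum_tmul (u i)
  let e := Fintype.equivFin (Σ i, Fin (m i))
  refine ⟨_, fun j => a (e.symm j).1, fun j => b _ (e.symm j).2, fun j => c _ (e.symm j).2, ?_⟩
  rw [e.symm.sum_comp fun p : Σ i, Fin (m i) => a p.1 ⊗ₜ[k] (b _ p.2 ⊗ₜ[k] c _ p.2),
    Fintype.sum_sigma]
  simp_rw [← TensorProduct.tmul_sum, ← hu]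

lemma exists_rep3 (k : Type*) [CommRing k] [AddCommMonoid X] [Module k X] [Coalgebra k X] (x : X) :
    ∃ (n : ℕ) (x1 x2 x3 : Fin n → X), Rep3 k x x1 x2 x3 :=
  TensorProduct.exists_fin_sum_tmul_tmul _

end Representations

section Convolution

variable {k X A B : Type*} [CommRing k] [CommRing X] [CommRing A] [CommRing B] [HopfAlgebra k X]
  [Algebra k A] [Algebra k B]

lemma Rep2.convMul_apply {x : X} {n : ℕ} {x1 x2 : Fin n → X} (h : Rep2 k x x1 x2)
    (f g : WithConv (X →ₐ[k] A)) : (f * g) x = ∑ i, f (x1 i) * g (x2 i) := by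
  rw [AlgHom.convMul_apply, h]
  simp

lemma Rep3.convMul_apply {x : X} {n : ℕ} {x1 x2 x3 : Fin n → X} (hx : Rep3 k x x1 x2 x3)
    (f g h : WithConv (X →ₐ[k] A)) :
    (f * (g * h)) x = ∑ i, f (x1 i) * (g (x2 i) * h (x3 i)) := by
  have key : ((LinearMap.mul' k A) ∘ₗ TensorProduct.map f.ofConv.toLinearMap
      ((LinearMap.mul' k A) ∘ₗ TensorProduct.map g.ofConv.toLinearMap h.ofConv.toLinearMap))
      (delta3 k x) = (f * (g * h)) x := by
    obtain ⟨n, a, b, hab⟩ := exists_rep2 (k := k) x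
    rw [hab.convMul_apply, delta3, LinearMap.comp_apply, LinearMap.comp_apply, hab]
    simp only [map_sum, LinearMap.lTensor_tmul, LinearMap.comp_apply, TensorProduct.map_tmul,
      LinearMap.mul'_apply]
    rfl
  rw [← key, hx]
  simp

/-- The convolution inverse `f ∘ S` of an algebra homomorphism. -/
noncomputable instance AlgHom.instInvConv : Inv (WithConv (X →ₐ[k] A)) where
  inv f := toConv (f.ofConv.comp (HopfAlgebra.antipodeAlgHom k X))

lemma AlgHom.convInv_apply (f : WithConv (X →ₐ[k] A)) (x : X) :
    f⁻¹ x = f (HopfAlgebra.antipode k x) := rfl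

/-- A convolution factor on which `P` acts through the counit may be dropped under `P`. -/
lemma map_convMul_mul {M : Type*} [AddCommGroup M] [Module k M] (P : A →ₗ[k] M)
    {g : WithConv (X →ₐ[k] A)}
    (hg : ∀ a v, P (g a * v) = Coalgebra.counit (R := k) a • P v)
    (f : WithConv (X →ₐ[k] A)) (a : X) (v : A) :
    P ((f * g) a * v) = P (f a * v) := by
  obtain ⟨n, a1, a2, ha⟩ := exists_rep2 (k := k) a
  have hcounit : a = ∑ i, Coalgebra.counit (R := k) (a2 i) • a1 i := by
    have := congr(TensorProduct.rid k X $(Coalgebra.lTensor_counit_comul (R := k) a))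
    rw [ha] at this
    simpa using this.symm
  rw [ha.convMul_apply, Finset.sum_mul, map_sum]
  conv_rhs => rw [hcounit]
  have hf : ∀ (c : k) (b : X), f (c • b) = c • f b := fun c b => map_smul f.ofConv c b
  have hs : f (∑ i, Coalgebra.counit (R := k) (a2 i) • a1 i) =
    ∑ i, f (Coalgebra.counit (R := k) (a2 i) • a1 i) := map_sum f.ofConv _ _
  rw [hs, Finset.sum_mul, map_sum]
  refine Finset.sum_congr rfl fun i _ => ?_
  rw [hf, smul_mul_assoc, map_smul, mul_right_comm, mul_comm, hg, mul_comm]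

lemma map_convMul_inv_mul {M : Type*} [AddCommGroup M] [Module k M] (P : A →ₗ[k] M)
    {g : WithConv (X →ₐ[k] A)}
    (hg : ∀ a v, P (g a * v) = Coalgebra.counit (R := k) a • P v)
    (f : WithConv (X →ₐ[k] A)) (a : X) (v : A) :
    P ((f * g⁻¹) a * v) = P (f a * v) :=
  map_convMul_mul P (fun a v => by
    rw [AlgHom.convInv_apply, hg, HopfAlgebra.counit_antipode]) f a v

/-- The convolution group of algebra homomorphisms from a cocommutative commutative Hopf algebra
to a commutative algebra. -/
noncomputable instance AlgHom.convCommGroup [Coalgebra.IsCocomm k X] :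
    CommGroup (WithConv (X →ₐ[k] A)) where
  inv_mul_cancel f := by
    ext x
    obtain ⟨n, a, b, hab⟩ := exists_rep2 (k := k) x
    rw [hab.convMul_apply]
    have hS := congr(f.ofConv $(HopfAlgebra.mul_antipode_rTensor_comul_apply (R := k) x))
    rw [hab] at hS
    simpa [AlgHom.convInv_apply] using hS
  mul_comm := mul_comm

variable [Coalgebra.IsCocomm k X]

/-- Composition with an algebra homomorphism as a homomorphism of convolution groups. -/
noncomputable def AlgHom.convPostcomp (X : Type*) [CommRing X] [HopfAlgebra k X]
    [Coalgebra.IsCocomm k X] (h : A →ₐ[k] B) : WithConv (X →ₐ[k] A) →* WithConv (X →ₐ[k] B) :=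
  MonoidHom.mk' (fun f : WithConv (X →ₐ[k] A) => toConv (h.comp f.ofConv)) fun f g => by
    rw [AlgHom.comp_convMul_distrib]

@[simp]
lemma AlgHom.convPostcomp_apply (h : A →ₐ[k] B) (f : WithConv (X →ₐ[k] A)) (x : X) :
    AlgHom.convPostcomp X h f x = h (f x) := rfl

lemma AlgHom.convPostcomp_inv (h : A →ₐ[k] B) (f : WithConv (X →ₐ[k] A)) :
    AlgHom.convPostcomp X h f⁻¹ = (AlgHom.convPostcomp X h f)⁻¹ := rfl

end Convolution

section Inclusions

variable (k X : Type*) [CommRing k] [CommRing X] [HopfAlgebra k X]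

/-- The inclusion `x ↦ x ⊗ 1`, as a point of the convolution group. -/
noncomputable def inclLeft : WithConv (X →ₐ[k] X ⊗[k] X) :=
  toConv Algebra.TensorProduct.includeLeft

/-- The inclusion `x ↦ 1 ⊗ x`, as a point of the convolution group. -/
noncomputable def inclRight : WithConv (X →ₐ[k] X ⊗[k] X) :=
  toConv Algebra.TensorProduct.includeRight

/-- The inclusion of the first of four tensor factors. -/
noncomputable def incl₁ : WithConv (X →ₐ[k] (X ⊗[k] X) ⊗[k] (X ⊗[k] X)) :=
  toConv (Algebra.TensorProduct.includeLeft.comp (inclLeft k X).ofConv)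

/-- The inclusion of the second of four tensor factors. -/
noncomputable def incl₂ : WithConv (X →ₐ[k] (X ⊗[k] X) ⊗[k] (X ⊗[k] X)) :=
  toConv (Algebra.TensorProduct.includeLeft.comp (inclRight k X).ofConv)

/-- The inclusion of the third of four tensor factors. -/
noncomputable def incl₃ : WithConv (X →ₐ[k] (X ⊗[k] X) ⊗[k] (X ⊗[k] X)) :=
  toConv (Algebra.TensorProduct.includeRight.comp (inclLeft k X).ofConv)

/-- The inclusion of the fourth of four tensor factors. -/
noncomputable def incl₄ : WithConv (X →ₐ[k] (X ⊗[k] X) ⊗[k] (X ⊗[k] X)) :=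
  toConv (Algebra.TensorProduct.includeRight.comp (inclRight k X).ofConv)

/-- The inclusion `x ⊗ w ↦ x ⊗ 1 ⊗ 1 ⊗ w` of the outer tensor factors. -/
noncomputable def inclOuter : X ⊗[k] X →ₐ[k] (X ⊗[k] X) ⊗[k] (X ⊗[k] X) :=
  Algebra.TensorProduct.map Algebra.TensorProduct.includeLeft Algebra.TensorProduct.includeRight

variable {k X}

@[simp] lemma inclLeft_apply (x : X) : inclLeft k X x = x ⊗ₜ 1 := rfl
@[simp] lemma inclRight_apply (x : X) : inclRight k X x = 1 ⊗ₜ x := rfl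
@[simp] lemma incl₁_apply (x : X) : incl₁ k X x = (x ⊗ₜ 1) ⊗ₜ (1 ⊗ₜ 1) := rfl
@[simp] lemma incl₂_apply (x : X) : incl₂ k X x = (1 ⊗ₜ x) ⊗ₜ (1 ⊗ₜ 1) := rfl
@[simp] lemma incl₃_apply (x : X) : incl₃ k X x = (1 ⊗ₜ 1) ⊗ₜ (x ⊗ₜ 1) := rfl
@[simp] lemma incl₄_apply (x : X) : incl₄ k X x = (1 ⊗ₜ 1) ⊗ₜ (1 ⊗ₜ x) := rfl
@[simp] lemma inclOuter_tmul (x w : X) :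
    inclOuter k X (x ⊗ₜ w) = (x ⊗ₜ 1) ⊗ₜ (1 ⊗ₜ w) := rfl

variable (k X)

/-- The point `x ↦ 1 ⊗ x⁽¹⁾ ⊗ x⁽²⁾ ⊗ 1` of the convolution group. -/
noncomputable def inclInner : WithConv (X →ₐ[k] (X ⊗[k] X) ⊗[k] (X ⊗[k] X)) :=
  incl₂ k X * incl₃ k X

/-- The twist `θ` as an algebra homomorphism. -/
noncomputable def twistAlgHom : X ⊗[k] X →ₐ[k] X ⊗[k] X :=
  Algebra.TensorProduct.productMap
    (inclLeft k X * ((inclLeft k X)⁻¹ * (inclRight k X)⁻¹)).ofConv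
    (inclRight k X * (inclLeft k X * inclRight k X)).ofConv

/-- The braiding `β` as an algebra homomorphism. -/
noncomputable def braidAlgHom :
    (X ⊗[k] X) ⊗[k] (X ⊗[k] X) →ₐ[k] (X ⊗[k] X) ⊗[k] (X ⊗[k] X) :=
  Algebra.TensorProduct.productMap
    (Algebra.TensorProduct.productMap (incl₃ k X).ofConv (incl₄ k X).ofConv)
    (Algebra.TensorProduct.productMap
      (incl₁ k X * ((incl₃ k X)⁻¹ * (incl₄ k X)⁻¹)).ofConv
      (incl₂ k X * (incl₃ k X * incl₄ k X)).ofConv)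

/-- The twist `θ₂ = β ∘ β ∘ (θ ⊗ θ)` as an algebra homomorphism. -/
noncomputable def twist₂AlgHom :
    (X ⊗[k] X) ⊗[k] (X ⊗[k] X) →ₐ[k] (X ⊗[k] X) ⊗[k] (X ⊗[k] X) :=
  (braidAlgHom k X).comp <| (braidAlgHom k X).comp <|
    Algebra.TensorProduct.map (twistAlgHom k X) (twistAlgHom k X)

variable {k X}

lemma twistAlgHom_tmul (x y : X) :
    twistAlgHom k X (x ⊗ₜ y) =
      (inclLeft k X * ((inclLeft k X)⁻¹ * (inclRight k X)⁻¹)) x *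
        (inclRight k X * (inclLeft k X * inclRight k X)) y := rfl

lemma braidAlgHom_tmul (x y z w : X) :
    braidAlgHom k X ((x ⊗ₜ y) ⊗ₜ (z ⊗ₜ w)) =
      (incl₃ k X x * incl₄ k X y) *
      ((incl₁ k X * ((incl₃ k X)⁻¹ * (incl₄ k X)⁻¹)) z *
        (incl₂ k X * (incl₃ k X * incl₄ k X)) w) := rfl

lemma inclLeft_mul_inclRight_apply (x : X) :
    (inclLeft k X * inclRight k X) x = Coalgebra.comul (R := k) x := by
  obtain ⟨n, a, b, hab⟩ := exists_rep2 (k := k) x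
  rw [hab.convMul_apply, hab]
  simp

lemma tmul_tmul_tmul_eq (x y z w : X) :
    (x ⊗ₜ[k] y) ⊗ₜ[k] (z ⊗ₜ[k] w) =
      inclOuter k X (x ⊗ₜ w) * (incl₂ k X y * incl₃ k X z) := by
  simp

lemma twistAlgHom_tmul_eq (x w : X) :
    twistAlgHom k X (x ⊗ₜ w) = twistAlgHom k X (inclLeft k X x) *
      twistAlgHom k X (inclRight k X w) := by
  rw [← map_mul]; simp

lemma inclOuter_tmul_eq (x w : X) :
    inclOuter k X (x ⊗ₜ w) = incl₁ k X x * incl₄ k X w := by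
  simp

lemma inclInner_mul_inclInner_of_isCointegral {γ : X} (hγ : IsCointegral k γ) (a : X) :
    inclInner k X a * inclInner k X γ = Coalgebra.counit (R := k) a • inclInner k X γ := by
  have h := map_mul (inclInner k X).ofConv a γ
  rw [(hγ a).1, map_smul] at h
  exact h.symm

section Multiplication

variable {lam : X →ₗ[k] k} {μ₂ : (X ⊗[k] X) ⊗[k] (X ⊗[k] X) →ₗ[k] X ⊗[k] X}
  (hμ : ∀ x y z w : X, μ₂ ((x ⊗ₜ[k] y) ⊗ₜ[k] (z ⊗ₜ[k] w)) =
    lam (y * HopfAlgebra.antipode k z) • (x ⊗ₜ[k] w))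

include hμ

lemma map_inclOuter_mul (t : X ⊗[k] X) (v : (X ⊗[k] X) ⊗[k] (X ⊗[k] X)) :
    μ₂ (inclOuter k X t * v) = t * μ₂ v := by
  induction t with
  | zero => simp
  | add s t hs ht => simp only [map_add, add_mul, hs, ht]
  | tmul a b =>
    induction v with
    | zero => simp
    | add s t hs ht => simp only [map_add, mul_add, hs, ht]
    | tmul p q =>
      induction p with
      | zero => simp
      | add s t hs ht => simp only [map_add, mul_add, TensorProduct.add_tmul, hs, ht]
      | tmul x y =>
        induction q with
        | zero => simp
        | add s t hs ht => simp only [map_add, mul_add, TensorProduct.tmul_add, hs, ht]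
        | tmul z w => simp [hμ]

lemma map_inclInner_mul (a : X) (v : (X ⊗[k] X) ⊗[k] (X ⊗[k] X)) :
    μ₂ (inclInner k X a * v) = Coalgebra.counit (R := k) a • μ₂ v := by
  obtain ⟨n, a1, a2, ha⟩ := exists_rep2 (k := k) a
  have hS := HopfAlgebra.mul_antipode_lTensor_comul_apply (R := k) a
  rw [ha] at hS
  simp only [map_sum, LinearMap.lTensor_tmul, LinearMap.mul'_apply] at hS
  rw [inclInner, ha.convMul_apply]
  induction v with
  | zero => simp
  | add s t hs ht => simp only [map_add, mul_add, smul_add, hs, ht]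
  | tmul p q =>
    induction p with
    | zero => simp
    | add s t hs ht => simp only [map_add, mul_add, smul_add, TensorProduct.add_tmul, hs, ht]
    | tmul x y =>
      induction q with
      | zero => simp
      | add s t hs ht => simp only [map_add, mul_add, smul_add, TensorProduct.tmul_add, hs, ht]
      | tmul z w =>
        have key : ∑ i, a1 i * y * HopfAlgebra.antipode k (a2 i * z) =
            Coalgebra.counit (R := k) a • (y * HopfAlgebra.antipode k z) := by
          rw [Algebra.smul_def, ← hS, Finset.sum_mul]
          refine Finset.sum_congr rfl fun i _ => ?_
          rw [HopfAlgebra.antipode_mul_distrib]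
          ring
        simp only [Finset.sum_mul, incl₂_apply, incl₃_apply,
          Algebra.TensorProduct.tmul_mul_tmul, one_mul, mul_one, map_sum, hμ]
        rw [← Finset.sum_smul, ← map_sum, key, map_smul, smul_assoc]

end Multiplication

lemma eq_twistAlgHom {θ : X ⊗[k] X →ₗ[k] X ⊗[k] X}
    (hθ : ∀ (x y : X) {n m : ℕ} (x1 x2 x3 : Fin n → X) (y1 y2 y3 : Fin m → X),
      Rep3 k x x1 x2 x3 → Rep3 k y y1 y2 y3 →
      θ (x ⊗ₜ[k] y) = ∑ i, ∑ j, (x1 i * HopfAlgebra.antipode k (x2 i) * y2 j) ⊗ₜ[k]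
        (y1 j * HopfAlgebra.antipode k (x3 i) * y3 j)) :
    θ = (twistAlgHom k X).toLinearMap := by
  refine TensorProduct.ext' fun x y => ?_
  obtain ⟨n, x1, x2, x3, hx⟩ := exists_rep3 k x
  obtain ⟨m, y1, y2, y3, hy⟩ := exists_rep3 k y
  rw [hθ x y x1 x2 x3 y1 y2 y3 hx hy, AlgHom.toLinearMap_apply, twistAlgHom_tmul,
    hx.convMul_apply, hy.convMul_apply, Finset.sum_mul_sum]
  refine Finset.sum_congr rfl fun i _ => Finset.sum_congr rfl fun j _ => ?_
  simp only [AlgHom.convInv_apply, inclLeft_apply, inclRight_apply,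
    Algebra.TensorProduct.tmul_mul_tmul, one_mul, mul_one]
  congr 1
  ring

lemma eq_braidAlgHom {β : (X ⊗[k] X) ⊗[k] (X ⊗[k] X) →ₗ[k] (X ⊗[k] X) ⊗[k] (X ⊗[k] X)}
    (hβ : ∀ (x y z w : X) {n m : ℕ} (z1 z2 z3 : Fin n → X) (w1 w2 w3 : Fin m → X),
      Rep3 k z z1 z2 z3 → Rep3 k w w1 w2 w3 →
      β ((x ⊗ₜ[k] y) ⊗ₜ[k] (z ⊗ₜ[k] w)) =
        ∑ i, ∑ j, (z1 i ⊗ₜ[k] w1 j) ⊗ₜ[k]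
          ((x * HopfAlgebra.antipode k (z2 i) * w2 j) ⊗ₜ[k]
            (y * HopfAlgebra.antipode k (z3 i) * w3 j))) :
    β = (braidAlgHom k X).toLinearMap := by
  refine TensorProduct.ext_fourfold' fun x y z w => ?_
  obtain ⟨n, z1, z2, z3, hz⟩ := exists_rep3 k z
  obtain ⟨m, w1, w2, w3, hw⟩ := exists_rep3 k w
  rw [hβ x y z w z1 z2 z3 w1 w2 w3 hz hw, AlgHom.toLinearMap_apply, braidAlgHom_tmul,
    hz.convMul_apply, hw.convMul_apply, Finset.sum_mul_sum, Finset.mul_sum]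
  refine Finset.sum_congr rfl fun i _ => ?_
  rw [Finset.mul_sum]
  refine Finset.sum_congr rfl fun j _ => ?_
  simp only [AlgHom.convInv_apply, incl₁_apply, incl₂_apply, incl₃_apply, incl₄_apply,
    Algebra.TensorProduct.tmul_mul_tmul, one_mul, mul_one, mul_assoc]

lemma eq_inclOuter_mul_inclInner {γ : X}
    {Δ₂ : X ⊗[k] X →ₗ[k] (X ⊗[k] X) ⊗[k] (X ⊗[k] X)}
    (hΔ₂ : ∀ (x w : X) {n : ℕ} (γ1 γ2 : Fin n → X), Rep2 k γ γ1 γ2 →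
      Δ₂ (x ⊗ₜ[k] w) = ∑ i, (x ⊗ₜ[k] γ1 i) ⊗ₜ[k] (γ2 i ⊗ₜ[k] w)) (t : X ⊗[k] X) :
    Δ₂ t = inclOuter k X t * inclInner k X γ := by
  obtain ⟨n, γ1, γ2, hγ⟩ := exists_rep2 (k := k) γ
  induction t with
  | zero => simp
  | add s t hs ht => simp only [map_add, add_mul, hs, ht]
  | tmul x w =>
    rw [hΔ₂ x w γ1 γ2 hγ, inclInner, hγ.convMul_apply, Finset.mul_sum]
    exact Finset.sum_congr rfl fun i _ => tmul_tmul_tmul_eq _ _ _ _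

variable [Coalgebra.IsCocomm k X]

lemma convPostcomp_inclOuter_inclLeft :
    AlgHom.convPostcomp X (inclOuter k X) (inclLeft k X) = incl₁ k X := by
  ext x; rfl

lemma convPostcomp_inclOuter_inclRight :
    AlgHom.convPostcomp X (inclOuter k X) (inclRight k X) = incl₄ k X := by
  ext x; rfl

lemma convPostcomp_twistAlgHom_inclLeft :
    AlgHom.convPostcomp X (twistAlgHom k X) (inclLeft k X) =
      inclLeft k X * ((inclLeft k X)⁻¹ * (inclRight k X)⁻¹) := by
  ext x; simp [twistAlgHom]

lemma convPostcomp_twistAlgHom_inclRight :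
    AlgHom.convPostcomp X (twistAlgHom k X) (inclRight k X) =
      inclRight k X * (inclLeft k X * inclRight k X) := by
  ext x; simp [twistAlgHom]

lemma convPostcomp_braidAlgHom_incl₁ :
    AlgHom.convPostcomp X (braidAlgHom k X) (incl₁ k X) = incl₃ k X := by
  ext x; simp [braidAlgHom]

lemma convPostcomp_braidAlgHom_incl₂ :
    AlgHom.convPostcomp X (braidAlgHom k X) (incl₂ k X) = incl₄ k X := by
  ext x; simp [braidAlgHom]

lemma convPostcomp_braidAlgHom_incl₃ :
    AlgHom.convPostcomp X (braidAlgHom k X) (incl₃ k X) =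
      incl₁ k X * ((incl₃ k X)⁻¹ * (incl₄ k X)⁻¹) := by
  ext x; simp [braidAlgHom]; exact one_mul _

lemma convPostcomp_braidAlgHom_incl₄ :
    AlgHom.convPostcomp X (braidAlgHom k X) (incl₄ k X) =
      incl₂ k X * (incl₃ k X * incl₄ k X) := by
  ext x; simp [braidAlgHom]; exact one_mul _

lemma convPostcomp_twist₂AlgHom_includeLeft (f : WithConv (X →ₐ[k] X ⊗[k] X)) :
    AlgHom.convPostcomp X (twist₂AlgHom k X)
        (AlgHom.convPostcomp X Algebra.TensorProduct.includeLeft f) =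
      AlgHom.convPostcomp X (braidAlgHom k X) (AlgHom.convPostcomp X (braidAlgHom k X)
        (AlgHom.convPostcomp X Algebra.TensorProduct.includeLeft
          (AlgHom.convPostcomp X (twistAlgHom k X) f))) := by
  ext x
  simp [twist₂AlgHom]

lemma convPostcomp_twist₂AlgHom_includeRight (f : WithConv (X →ₐ[k] X ⊗[k] X)) :
    AlgHom.convPostcomp X (twist₂AlgHom k X)
        (AlgHom.convPostcomp X Algebra.TensorProduct.includeRight f) =
      AlgHom.convPostcomp X (braidAlgHom k X) (AlgHom.convPostcomp X (braidAlgHom k X)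
        (AlgHom.convPostcomp X Algebra.TensorProduct.includeRight
          (AlgHom.convPostcomp X (twistAlgHom k X) f))) := by
  ext x
  simp [twist₂AlgHom]

lemma convPostcomp_includeLeft_inclLeft :
    AlgHom.convPostcomp X Algebra.TensorProduct.includeLeft (inclLeft k X) = incl₁ k X := rfl

lemma convPostcomp_includeLeft_inclRight :
    AlgHom.convPostcomp X Algebra.TensorProduct.includeLeft (inclRight k X) = incl₂ k X := rfl

lemma convPostcomp_includeRight_inclLeft :
    AlgHom.convPostcomp X Algebra.TensorProduct.includeRight (inclLeft k X) = incl₃ k X := rfl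

lemma convPostcomp_includeRight_inclRight :
    AlgHom.convPostcomp X Algebra.TensorProduct.includeRight (inclRight k X) = incl₄ k X := rfl

variable (k X) in
/-- The point `x ↦ x⁽²⁾ ⊗ x⁽¹⁾ ⊗ 1 ⊗ x⁽³⁾` of the convolution group. -/
noncomputable def inclSpread : WithConv (X →ₐ[k] (X ⊗[k] X) ⊗[k] (X ⊗[k] X)) :=
  incl₂ k X * AlgHom.convPostcomp X (inclOuter k X) (inclLeft k X * inclRight k X)

lemma convPostcomp_twist₂AlgHom_incl₁ :
    AlgHom.convPostcomp X (twist₂AlgHom k X) (incl₁ k X) =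
      AlgHom.convPostcomp X (inclOuter k X)
        (AlgHom.convPostcomp X (twistAlgHom k X) (inclLeft k X)) * (inclInner k X)⁻¹ := by
  rw [← convPostcomp_includeLeft_inclLeft, convPostcomp_twist₂AlgHom_includeLeft,
    convPostcomp_twistAlgHom_inclLeft, inclInner]
  simp only [map_mul, AlgHom.convPostcomp_inv,
    convPostcomp_inclOuter_inclLeft, convPostcomp_inclOuter_inclRight,
    convPostcomp_includeLeft_inclLeft,
    convPostcomp_includeLeft_inclRight, convPostcomp_braidAlgHom_incl₁,
    convPostcomp_braidAlgHom_incl₂, convPostcomp_braidAlgHom_incl₃, convPostcomp_braidAlgHom_incl₄]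
  apply Additive.ofMul.injective
  simp only [ofMul_mul, ofMul_inv]
  abel

lemma convPostcomp_twist₂AlgHom_incl₂ :
    AlgHom.convPostcomp X (twist₂AlgHom k X) (incl₂ k X) = inclSpread k X * inclInner k X := by
  rw [← convPostcomp_includeLeft_inclRight, convPostcomp_twist₂AlgHom_includeLeft,
    convPostcomp_twistAlgHom_inclRight, inclInner, inclSpread]
  simp only [map_mul, convPostcomp_inclOuter_inclLeft, convPostcomp_inclOuter_inclRight,
    convPostcomp_includeLeft_inclLeft,
    convPostcomp_includeLeft_inclRight, convPostcomp_braidAlgHom_incl₁,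
    convPostcomp_braidAlgHom_incl₂, convPostcomp_braidAlgHom_incl₃, convPostcomp_braidAlgHom_incl₄]
  apply Additive.ofMul.injective
  simp only [ofMul_mul, ofMul_inv]
  abel

lemma convPostcomp_twist₂AlgHom_incl₃ :
    AlgHom.convPostcomp X (twist₂AlgHom k X) (incl₃ k X) = (inclSpread k X)⁻¹ := by
  rw [← convPostcomp_includeRight_inclLeft, convPostcomp_twist₂AlgHom_includeRight,
    convPostcomp_twistAlgHom_inclLeft, inclSpread]
  simp only [map_mul, AlgHom.convPostcomp_inv,
    convPostcomp_inclOuter_inclLeft, convPostcomp_inclOuter_inclRight,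
    convPostcomp_includeRight_inclLeft,
    convPostcomp_includeRight_inclRight, convPostcomp_braidAlgHom_incl₁,
    convPostcomp_braidAlgHom_incl₂, convPostcomp_braidAlgHom_incl₃, convPostcomp_braidAlgHom_incl₄]
  apply Additive.ofMul.injective
  simp only [ofMul_mul, ofMul_inv]
  abel

lemma convPostcomp_twist₂AlgHom_incl₄ :
    AlgHom.convPostcomp X (twist₂AlgHom k X) (incl₄ k X) =
      AlgHom.convPostcomp X (inclOuter k X)
        (AlgHom.convPostcomp X (twistAlgHom k X) (inclRight k X)) * inclInner k X := by
  rw [← convPostcomp_includeRight_inclRight, convPostcomp_twist₂AlgHom_includeRight,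
    convPostcomp_twistAlgHom_inclRight, inclInner]
  simp only [map_mul, AlgHom.convPostcomp_inv,
    convPostcomp_inclOuter_inclLeft, convPostcomp_inclOuter_inclRight,
    convPostcomp_includeRight_inclLeft,
    convPostcomp_includeRight_inclRight, convPostcomp_braidAlgHom_incl₁,
    convPostcomp_braidAlgHom_incl₂, convPostcomp_braidAlgHom_incl₃, convPostcomp_braidAlgHom_incl₄]
  apply Additive.ofMul.injective
  simp only [ofMul_mul, ofMul_inv]
  abel

lemma convPostcomp_twist₂AlgHom_inclInner :
    AlgHom.convPostcomp X (twist₂AlgHom k X) (inclInner k X) = inclInner k X := by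
  conv_lhs => rw [inclInner, map_mul, convPostcomp_twist₂AlgHom_incl₂,
    convPostcomp_twist₂AlgHom_incl₃]
  rw [mul_comm (inclSpread k X)]
  exact mul_inv_cancel_right (inclInner k X) (inclSpread k X)

/-- A map on which `inclInner` acts through the counit does not see the inner part of `θ₂`. -/
lemma map_twist₂AlgHom_inclOuter_mul {M : Type*} [AddCommGroup M] [Module k M]
    (P : (X ⊗[k] X) ⊗[k] (X ⊗[k] X) →ₗ[k] M)
    (hP : ∀ a v, P (inclInner k X a * v) = Coalgebra.counit (R := k) a • P v)
    (t : X ⊗[k] X) (v : (X ⊗[k] X) ⊗[k] (X ⊗[k] X)) :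
    P (twist₂AlgHom k X (inclOuter k X t) * v) =
      P (inclOuter k X (twistAlgHom k X t) * v) := by
  induction t with
  | zero => simp
  | add s t hs ht => simp only [map_add, add_mul, hs, ht]
  | tmul x w =>
    have h1 := congr(($(convPostcomp_twist₂AlgHom_incl₁ (k := k) (X := X))) x)
    have h4 := congr(($(convPostcomp_twist₂AlgHom_incl₄ (k := k) (X := X))) w)
    rw [AlgHom.convPostcomp_apply] at h1 h4
    rw [inclOuter_tmul_eq, map_mul (twist₂AlgHom k X), h1, h4, mul_assoc,
      map_convMul_inv_mul P hP, mul_left_comm, map_convMul_mul P hP, mul_left_comm,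
      twistAlgHom_tmul_eq, map_mul (inclOuter k X), mul_assoc]
    rfl

section Multiplication

variable {lam : X →ₗ[k] k} {μ₂ : (X ⊗[k] X) ⊗[k] (X ⊗[k] X) →ₗ[k] X ⊗[k] X}
  (hμ : ∀ x y z w : X, μ₂ ((x ⊗ₜ[k] y) ⊗ₜ[k] (z ⊗ₜ[k] w)) =
    lam (y * HopfAlgebra.antipode k z) • (x ⊗ₜ[k] w))

include hμ

lemma map_inclSpread (hlam : IsIntegralFunctional k lam) (u : X) :
    μ₂ (inclSpread k X u) = lam u • 1 := by
  obtain ⟨n, a, b, hu⟩ := exists_rep2 (k := k) u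
  have h₂ (x : X) : μ₂ (incl₂ k X x) = lam x • 1 := by
    simp [hμ, HopfAlgebra.antipode_one, Algebra.TensorProduct.one_def]
  rw [inclSpread, hu.convMul_apply, map_sum]
  have key (i : Fin n) : μ₂ (incl₂ k X (a i) * AlgHom.convPostcomp X (inclOuter k X)
      (inclLeft k X * inclRight k X) (b i)) = Coalgebra.comul (R := k) (lam (a i) • b i) := by
    rw [AlgHom.convPostcomp_apply, mul_comm, map_inclOuter_mul hμ, h₂,
      inclLeft_mul_inclRight_apply, map_smul, mul_smul_comm, mul_one]
  simp_rw [key]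
  rw [← map_sum, (hlam u a b hu).2, map_smul, Bialgebra.comul_one]

lemma twistAlgHom_map (hlam : IsIntegralFunctional k lam) (x y z w : X) :
    twistAlgHom k X (μ₂ ((x ⊗ₜ y) ⊗ₜ (z ⊗ₜ w))) =
      μ₂ (twist₂AlgHom k X ((x ⊗ₜ y) ⊗ₜ (z ⊗ₜ w))) := by
  have h2 := congr(($(convPostcomp_twist₂AlgHom_incl₂ (k := k) (X := X))) y)
  have h3 := congr(($(convPostcomp_twist₂AlgHom_incl₃ (k := k) (X := X))) z)
  rw [AlgHom.convPostcomp_apply] at h2 h3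
  have hspread : inclSpread k X y * (inclSpread k X)⁻¹ z =
      inclSpread k X (y * HopfAlgebra.antipode k z) :=
    (map_mul (inclSpread k X).ofConv _ _).symm
  rw [hμ, map_smul, tmul_tmul_tmul_eq x y z w, map_mul (twist₂AlgHom k X),
    map_twist₂AlgHom_inclOuter_mul μ₂ (map_inclInner_mul hμ), map_inclOuter_mul hμ,
    map_mul (twist₂AlgHom k X), h2, h3, map_convMul_mul μ₂ (map_inclInner_mul hμ), hspread,
    map_inclSpread hμ hlam, mul_smul_comm, mul_one]

end Multiplication

lemma twist₂AlgHom_inclOuter_mul_inclInner {γ : X} (hγ : IsCointegral k γ) (t : X ⊗[k] X) :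
    twist₂AlgHom k X (inclOuter k X t * inclInner k X γ) =
      inclOuter k X (twistAlgHom k X t) * inclInner k X γ := by
  have hinner := congr(($(convPostcomp_twist₂AlgHom_inclInner (k := k) (X := X))) γ)
  rw [AlgHom.convPostcomp_apply] at hinner
  have key := map_twist₂AlgHom_inclOuter_mul
    (LinearMap.mulRight k (inclInner k X γ)) (fun a v => by
      rw [LinearMap.mulRight_apply, LinearMap.mulRight_apply, mul_right_comm,
        inclInner_mul_inclInner_of_isCointegral hγ, smul_mul_assoc, mul_comm v]) t 1
  simp only [LinearMap.mulRight_apply, mul_one] at key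
  rw [map_mul (twist₂AlgHom k X), hinner, key]

end Inclusions

/-- the twist `θ` commutes with the Frobenius multiplication `μ₂` and
comultiplication `Δ₂`: `θ ∘ μ₂ = μ₂ ∘ θ₂` and `Δ₂ ∘ θ = θ₂ ∘ Δ₂`, where
`θ₂ = β ∘ β ∘ (θ ⊗ θ)`. -/
theorem twist_commutes_with_frobenius (k X : Type*) [CommRing k] [CommRing X]
    [HopfAlgebra k X]
    (S : X →ₗ[k] X) (hS : S = HopfAlgebra.antipode (R := k))
    (hinv : ∀ a : X, S (S a) = a)
    (hcc : ∀ a : X, TensorProduct.comm k X X (Coalgebra.comul a) = Coalgebra.comul a)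
    (lam : X →ₗ[k] k) (hlam : IsIntegralFunctional k lam)
    (γ : X) (hγ : IsCointegral k γ)
    (μ₂ : (X ⊗[k] X) ⊗[k] (X ⊗[k] X) →ₗ[k] X ⊗[k] X)
    (hμ : ∀ x y z w : X,
      μ₂ ((x ⊗ₜ[k] y) ⊗ₜ[k] (z ⊗ₜ[k] w)) = lam (y * S z) • (x ⊗ₜ[k] w))
    (Δ₂ : X ⊗[k] X →ₗ[k] (X ⊗[k] X) ⊗[k] (X ⊗[k] X))
    (hΔ₂ : ∀ (x w : X) {n : ℕ} (γ1 γ2 : Fin n → X), Rep2 k γ γ1 γ2 →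
      Δ₂ (x ⊗ₜ[k] w) = ∑ i, (x ⊗ₜ[k] γ1 i) ⊗ₜ[k] (γ2 i ⊗ₜ[k] w))
    (β : (X ⊗[k] X) ⊗[k] (X ⊗[k] X) →ₗ[k] (X ⊗[k] X) ⊗[k] (X ⊗[k] X))
    (hβ : ∀ (x y z w : X) {n m : ℕ} (z1 z2 z3 : Fin n → X) (w1 w2 w3 : Fin m → X),
      Rep3 k z z1 z2 z3 → Rep3 k w w1 w2 w3 →
      β ((x ⊗ₜ[k] y) ⊗ₜ[k] (z ⊗ₜ[k] w)) =
        ∑ i, ∑ j, (z1 i ⊗ₜ[k] w1 j) ⊗ₜ[k]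
          ((x * S (z2 i) * w2 j) ⊗ₜ[k] (y * S (z3 i) * w3 j)))
    (θ : X ⊗[k] X →ₗ[k] X ⊗[k] X)
    (hθ : ∀ (x y : X) {n m : ℕ} (x1 x2 x3 : Fin n → X) (y1 y2 y3 : Fin m → X),
      Rep3 k x x1 x2 x3 → Rep3 k y y1 y2 y3 →
      θ (x ⊗ₜ[k] y) = ∑ i, ∑ j,
        (x1 i * S (x2 i) * y2 j) ⊗ₜ[k] (y1 j * S (x3 i) * y3 j)) :
    (θ ∘ₗ μ₂ = μ₂ ∘ₗ (β ∘ₗ β ∘ₗ TensorProduct.map θ θ)) ∧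
    (Δ₂ ∘ₗ θ = (β ∘ₗ β ∘ₗ TensorProduct.map θ θ) ∘ₗ Δ₂) := by
  subst hS
  have : Coalgebra.IsCocomm k X := ⟨LinearMap.ext hcc⟩
  obtain rfl := eq_twistAlgHom hθ
  obtain rfl := eq_braidAlgHom hβ
  have hθ₂ : (braidAlgHom k X).toLinearMap ∘ₗ (braidAlgHom k X).toLinearMap ∘ₗ
      TensorProduct.map (twistAlgHom k X).toLinearMap (twistAlgHom k X).toLinearMap =
      (twist₂AlgHom k X).toLinearMap := rfl
  rw [hθ₂]
  refine ⟨TensorProduct.ext_fourfold' fun x y z w => twistAlgHom_map hμ hlam x y z w,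
    LinearMap.ext fun t => ?_⟩
  simp only [LinearMap.comp_apply, AlgHom.toLinearMap_apply, eq_inclOuter_mul_inclInner hΔ₂,
    twist₂AlgHom_inclOuter_mul_inclInner hγ]
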